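/- Fix an integer ℓ ≥ 2. There exists a constant d (depending only on ℓ and the universal machine) such that for every ℓ-party nondeterministic communication protocol Π = (𝓡, t) over D = {0,1}^{n₁} × ⋯ × {0,1}^{n_ℓ} and every (x₁,…,x_ℓ) ∈ D: C(t̃ ∣ Π) ≥ (1/(ℓ−1))·Σ_{i=1}^{ℓ} C(t̃ ∣ x_i, Π) − (1/(ℓ−1))·log₂ ρ(t̃) − d·log₂ n − d, where t̃ = t(x₁,…,x_ℓ) and n = max(n₁,…,n_ℓ). -/

import Mathlib

/-- A machine maps a program and a condition string to at most one output string. -/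
abbrev Machine := List Bool → List Bool →. List Bool

/-- Conditional Kolmogorov complexity relative to machine `U`. -/
noncomputable def KC (U : Machine) (x u : List Bool) : ℕ :=
  sInf { k | ∃ p : List Bool, p.length = k ∧ x ∈ U p u }

/-- `U` is a universal machine. -/
def IsUniversal (U : Machine) : Prop :=
  Partrec₂ U ∧
    ∀ V : Machine, Partrec₂ V →
      ∃ c : ℕ, ∀ p u x, x ∈ V p u → ∃ q : List Bool, x ∈ U q u ∧ q.length ≤ p.length + c

/-- Self-delimiting encoding of a string. -/
def eBits (x : List Bool) : List Bool := (x.map fun b => [b, b]).flatten ++ [true, false]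

/-- The fixed computable pairing of strings. -/
def ePair (x y : List Bool) : List Bool := eBits x ++ y

/-- Encoding of a list of strings. -/
def eList (l : List (List Bool)) : List Bool := (l.map eBits).flatten

/-- Conditional mutual information `I(x : y ∣ u)`. -/
noncomputable def MI (U : Machine) (x y u : List Bool) : ℝ :=
  (KC U x u : ℝ) + KC U y u - KC U (ePair x y) u

/-- Conditional triple information `I(x : y : w ∣ u)`. -/
noncomputable def TI (U : Machine) (x y w u : List Bool) : ℝ :=
  (KC U x u : ℝ) + KC U y u + KC U w u - KC U (ePair x y) u - KC U (ePair x w) u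
    - KC U (ePair y w) u + KC U (ePair x (ePair y w)) u

/-- A combinatorial rectangle, given by its list of rows and list of columns. -/
structure Rect where
  rows : List (List Bool)
  cols : List (List Bool)
deriving DecidableEq

/-- Canonical encoding of a rectangle. -/
def encRect (R : Rect) : List Bool := ePair (eList R.rows) (eList R.cols)

/-- The list of all bit strings of length `n`. -/
def allBV : ℕ → List (List Bool)
  | 0 => [[]]
  | n + 1 => (allBV n).flatMap fun x => [false :: x, true :: x]

/-- A nondeterministic communication protocol over `{0,1}^{n₁} × {0,1}^{n₂}`:
a finite family of rectangles covering the domain together with a transcript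
function selecting, for every cell of the domain, a rectangle containing it. -/
structure Protocol (n₁ n₂ : ℕ) where
  rects : List Rect
  trans : List Bool → List Bool → Rect
  rows_len : ∀ R ∈ rects, ∀ s ∈ R.rows, s.length = n₁
  cols_len : ∀ R ∈ rects, ∀ s ∈ R.cols, s.length = n₂
  trans_mem : ∀ x y : List Bool, x.length = n₁ → y.length = n₂ → trans x y ∈ rects
  trans_row : ∀ x y : List Bool, x.length = n₁ → y.length = n₂ → x ∈ (trans x y).rows
  trans_col : ∀ x y : List Bool, x.length = n₁ → y.length = n₂ → y ∈ (trans x y).cols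

/-- The thickness of a cell: the number of rectangles of the protocol containing it. -/
def cellThick {n₁ n₂ : ℕ} (P : Protocol n₁ n₂) (x y : List Bool) : ℕ :=
  P.rects.countP fun R => decide (x ∈ R.rows ∧ y ∈ R.cols)

/-- The thickness of a rectangle: the maximal thickness of a cell of the rectangle. -/
def rectThick {n₁ n₂ : ℕ} (P : Protocol n₁ n₂) (R : Rect) : ℕ :=
  (R.rows.flatMap fun x => R.cols.map fun y => cellThick P x y).foldr max 0

/-- Canonical encoding of a protocol: the list of its rectangles followed by
the graph of the transcript function on the domain. -/
def encProt {n₁ n₂ : ℕ} (P : Protocol n₁ n₂) : List Bool :=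
  ePair (eList (P.rects.map encRect))
    (eList ((allBV n₁).flatMap fun x => (allBV n₂).map fun y => encRect (P.trans x y)))

/-- Canonical encoding of an `ℓ`-dimensional rectangle `S₁ × ⋯ × S_ℓ`. -/
def encRectL {ℓ : ℕ} (R : Fin ℓ → List (List Bool)) : List Bool :=
  eList ((List.finRange ℓ).map fun i => eList (R i))

/-- An `ℓ`-party nondeterministic communication protocol over
`{0,1}^{nn 0} × ⋯ × {0,1}^{nn (ℓ-1)}`. -/
structure MProtocol (ℓ : ℕ) (nn : Fin ℓ → ℕ) where
  rects : List (Fin ℓ → List (List Bool))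
  trans : (Fin ℓ → List Bool) → (Fin ℓ → List (List Bool))
  sides_len : ∀ R ∈ rects, ∀ i : Fin ℓ, ∀ s ∈ R i, s.length = nn i
  trans_mem : ∀ x : Fin ℓ → List Bool, (∀ i, (x i).length = nn i) → trans x ∈ rects
  trans_contains : ∀ x : Fin ℓ → List Bool, (∀ i, (x i).length = nn i) → ∀ i, x i ∈ trans x i

/-- The thickness of a cell: the number of rectangles of the protocol containing it. -/
def cellThickL {ℓ : ℕ} {nn : Fin ℓ → ℕ} (P : MProtocol ℓ nn) (x : Fin ℓ → List Bool) : ℕ :=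
  P.rects.countP fun R => decide (∀ i, x i ∈ R i)

/-- The thickness of a rectangle: the maximal thickness of a cell of the rectangle. -/
def rectThickL {ℓ : ℕ} {nn : Fin ℓ → ℕ} (P : MProtocol ℓ nn)
    (R : Fin ℓ → List (List Bool)) : ℕ :=
  (Fintype.piFinset fun i => (R i).toFinset).sup (cellThickL P)

/-- Canonical encoding of an `ℓ`-party protocol. -/
noncomputable def encMProt {ℓ : ℕ} {nn : Fin ℓ → ℕ} (P : MProtocol ℓ nn) : List Bool :=
  ePair (eList (P.rects.map encRectL))
    (eList (((Fintype.piFinset fun i : Fin ℓ => (allBV (nn i)).toFinset).toList).map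
      fun x => encRectL (P.trans x)))

theorem PrimrecRel.exists_lt_nat {α : Type} [Primcodable α] {R : ℕ → α → Prop}
    (hR : PrimrecRel R) : PrimrecRel fun n a => ∃ m < n, R m a :=
  (hR.exists_mem_list.comp (Primrec.list_range.comp Primrec.fst) Primrec.snd).of_eq (by simp)

theorem PrimrecRel.forall_lt_nat {α : Type} [Primcodable α] {R : ℕ → α → Prop}
    (hR : PrimrecRel R) : PrimrecRel fun n a => ∀ m < n, R m a :=
  (hR.forall_mem_list.comp (Primrec.list_range.comp Primrec.fst) Primrec.snd).of_eq (by simp)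

/-- The predicates of the form `∃ n, q (a, n)` with `q` primitive recursive. -/
def SigmaPred {α : Type} [Primcodable α] (p : α → Prop) : Prop :=
  ∃ q : α × ℕ → Prop, PrimrecPred q ∧ ∀ a, p a ↔ ∃ n, q (a, n)

namespace SigmaPred

variable {α β : Type} [Primcodable α] [Primcodable β]

theorem of_primrecPred {p : α → Prop} (hp : PrimrecPred p) : SigmaPred p :=
  ⟨fun x => p x.1, hp.comp Primrec.fst, fun _ => ⟨fun h => ⟨0, h⟩, fun ⟨_, h⟩ => h⟩⟩

theorem comp {p : β → Prop} (hp : SigmaPred p) {f : α → β} (hf : Primrec f) :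
    SigmaPred fun a => p (f a) := by
  obtain ⟨q, hq, h⟩ := hp
  exact ⟨fun x => q (f x.1, x.2), hq.comp ((hf.comp Primrec.fst).pair Primrec.snd), fun a => h _⟩

theorem of_iff {p q : α → Prop} (hp : SigmaPred p) (h : ∀ a, q a ↔ p a) : SigmaPred q := by
  obtain rfl : p = q := funext fun a => (propext (h a)).symm
  exact hp

theorem exists_snd {p : α × β → Prop} (hp : SigmaPred p) : SigmaPred fun a => ∃ b, p (a, b) := by
  classical
  obtain ⟨q, hq, h⟩ := hp
  have hf : Primrec fun x : α × ℕ =>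
      Option.casesOn (motive := fun _ => Bool) (Encodable.decode (α := β) x.2.unpair.1) false
        fun b => decide (q ((x.1, b), x.2.unpair.2)) := by
    refine Primrec.option_casesOn
      (Primrec.decode.comp (Primrec.fst.comp (Primrec.unpair.comp Primrec.snd)))
      (Primrec.const false) ?_
    have hg : Primrec fun y : (α × ℕ) × β => ((y.1.1, y.2), y.1.2.unpair.2) :=
      ((Primrec.fst.comp Primrec.fst).pair Primrec.snd).pair
        (Primrec.snd.comp (Primrec.unpair.comp (Primrec.snd.comp Primrec.fst)))
    exact (hq.comp hg).decide
  refine ⟨fun x => Option.casesOn (motive := fun _ => Bool)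
      (Encodable.decode (α := β) x.2.unpair.1) false
        (fun b => decide (q ((x.1, b), x.2.unpair.2))) = true,
    Primrec.eq.comp hf (Primrec.const true), fun a => ⟨?_, ?_⟩⟩
  · rintro ⟨b, hb⟩
    obtain ⟨n, hn⟩ := (h _).1 hb
    exact ⟨Nat.pair (Encodable.encode b) n, by simpa using hn⟩
  · rintro ⟨n, hn⟩
    cases hd : Encodable.decode (α := β) n.unpair.1 with
    | none => simp [hd] at hn
    | some b => exact ⟨b, (h _).2 ⟨_, by simpa [hd] using hn⟩⟩

theorem and {p q : α → Prop} (hp : SigmaPred p) (hq : SigmaPred q) :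
    SigmaPred fun a => p a ∧ q a := by
  obtain ⟨p', hp', h⟩ := hp
  obtain ⟨q', hq', h'⟩ := hq
  have : SigmaPred fun a => ∃ m : ℕ × ℕ, p' (a, m.1) ∧ q' (a, m.2) := by
    have h1 : PrimrecPred fun x : α × ℕ × ℕ => p' (x.1, x.2.1) :=
      hp'.comp (Primrec.fst.pair (Primrec.fst.comp Primrec.snd))
    have h2 : PrimrecPred fun x : α × ℕ × ℕ => q' (x.1, x.2.2) :=
      hq'.comp (Primrec.fst.pair (Primrec.snd.comp Primrec.snd))
    exact exists_snd (of_primrecPred (h1.and h2))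
  refine this.of_iff fun a => ?_
  rw [h, h']
  constructor
  · rintro ⟨⟨m, hm⟩, n, hn⟩
    exact ⟨(m, n), hm, hn⟩
  · rintro ⟨m, hm, hn⟩
    exact ⟨⟨_, hm⟩, _, hn⟩

theorem forall_mem {p : α × β → Prop} (hp : SigmaPred p) {l : α → List β} (hl : Primrec l) :
    SigmaPred fun a => ∀ b ∈ l a, p (a, b) := by
  obtain ⟨q, hq, h⟩ := hp
  have h1 : PrimrecRel fun (n : ℕ) (y : α × β) => q (y, n) :=
    hq.comp (Primrec.snd.pair Primrec.fst)
  have h2 : PrimrecPred fun y : β × α × ℕ => ∃ n < y.2.2, q ((y.2.1, y.1), n) :=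
    PrimrecRel.comp (R := fun (n : ℕ) (y : α × β) => ∃ m < n, q (y, m)) h1.exists_lt_nat
      (Primrec.snd.comp Primrec.snd) ((Primrec.fst.comp Primrec.snd).pair Primrec.fst)
  have h3 : PrimrecRel fun (b : β) (x : α × ℕ) => ∃ n < x.2, q ((x.1, b), n) := h2
  refine ⟨fun x => ∀ b ∈ l x.1, ∃ n < x.2, q ((x.1, b), n),
    h3.forall_mem_list.comp (hl.comp Primrec.fst) Primrec.id, fun a => ⟨fun H => ?_, ?_⟩⟩
  · have H' : ∀ b ∈ l a, ∃ n, q ((a, b), n) := fun b hb => (h _).1 (H b hb)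
    clear H
    change ∃ N, ∀ b ∈ l a, ∃ n < N, q ((a, b), n)
    generalize l a = L at H' ⊢
    induction L with
    | nil => exact ⟨0, by simp⟩
    | cons b L ih =>
      obtain ⟨N, hN⟩ := ih fun c hc => H' c (List.mem_cons_of_mem _ hc)
      obtain ⟨n, hn⟩ := H' b List.mem_cons_self
      refine ⟨max N (n + 1), fun c hc => ?_⟩
      rcases List.mem_cons.1 hc with rfl | hc
      · exact ⟨n, by simp, hn⟩
      · obtain ⟨m, hm, hm'⟩ := hN c hc
        exact ⟨m, lt_max_of_lt_left hm, hm'⟩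
  · rintro ⟨N, hN⟩ b hb
    obtain ⟨n, -, hn⟩ := hN b hb
    exact (h _).2 ⟨n, hn⟩

end SigmaPred

theorem primrecRel_mem {α : Type} [Primcodable α] :
    PrimrecRel fun (a : α) (l : List α) => a ∈ l := by
  have : PrimrecRel fun (l : List α) (a : α) => ∃ b ∈ l, b = a :=
    PrimrecRel.exists_mem_list Primrec.eq
  exact this.swap.of_eq fun a l => by simp

theorem primrecPred_nodup {α : Type} [Primcodable α] :
    PrimrecPred fun l : List α => l.Nodup := by
  have h1 : PrimrecRel fun (i : ℕ) (y : ℕ × List α) => i < y.1 → y.2[i]? ≠ y.2[y.1]? := by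
    have ha : PrimrecPred fun x : ℕ × ℕ × List α => x.1 < x.2.1 :=
      Primrec.nat_lt.comp Primrec.fst (Primrec.fst.comp Primrec.snd)
    have hb : PrimrecPred fun x : ℕ × ℕ × List α => x.2.2[x.1]? = x.2.2[x.2.1]? :=
      Primrec.eq.comp
        (Primrec.list_getElem?.comp (Primrec.snd.comp Primrec.snd) Primrec.fst)
        (Primrec.list_getElem?.comp (Primrec.snd.comp Primrec.snd)
          (Primrec.fst.comp Primrec.snd))
    exact (ha.not.or hb.not).of_eq fun x => by tauto
  have h2 : PrimrecPred fun y : ℕ × List α => ∀ i < y.1, i < y.1 → y.2[i]? ≠ y.2[y.1]? :=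
    PrimrecRel.comp (R := fun (n : ℕ) (y : ℕ × List α) => ∀ i < n, i < y.1 → y.2[i]? ≠ y.2[y.1]?)
      h1.forall_lt_nat Primrec.fst Primrec.id
  have h2' : PrimrecRel fun (j : ℕ) (l : List α) => ∀ i < j, i < j → l[i]? ≠ l[j]? := h2
  have h3 : PrimrecPred fun l : List α => ∀ j < l.length, ∀ i < j, i < j → l[i]? ≠ l[j]? :=
    h2'.forall_lt_nat.comp Primrec.list_length Primrec.id
  refine h3.of_eq fun l => ?_
  rw [List.nodup_iff_getElem?_ne_getElem?]
  exact ⟨fun h i j hij hj => h j hj i hij hij, fun h j hj i hij _ => h i j hij hj⟩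

namespace SigmaPred

variable {α β : Type} [Primcodable α] [Primcodable β]

theorem exists_list {p : α × β → Prop} (hp : SigmaPred p) {N : α → ℕ} (hN : Primrec N) :
    SigmaPred fun a => ∃ l : List β, l.Nodup ∧ l.length = N a ∧ ∀ b ∈ l, p (a, b) := by
  refine exists_snd (p := fun x : α × List β => x.2.Nodup ∧ x.2.length = N x.1 ∧
    ∀ b ∈ x.2, p (x.1, b)) ?_
  refine and (of_primrecPred (primrecPred_nodup.comp Primrec.snd)) (and ?_ ?_)
  · exact of_primrecPred (Primrec.eq.comp (Primrec.list_length.comp Primrec.snd)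
      (hN.comp Primrec.fst))
  · exact forall_mem (p := fun y : (α × List β) × β => p (y.1.1, y.2))
      (hp.comp ((Primrec.fst.comp Primrec.fst).pair Primrec.snd)) Primrec.snd

end SigmaPred

theorem sigmaPred_machine {U : Machine} (hU : Partrec₂ U) :
    SigmaPred fun x : List Bool × List Bool × List Bool => x.1 ∈ U x.2.1 x.2.2 := by
  obtain ⟨c, hc⟩ := Nat.Partrec.Code.exists_code.1 hU
  refine ⟨fun x => Nat.Partrec.Code.evaln x.2 c (Encodable.encode x.1.2) =
    some (Encodable.encode x.1.1), ?_, fun x => ?_⟩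
  · refine Primrec.eq.comp (Nat.Partrec.Code.primrec_evaln.comp
      ((Primrec.snd.pair (Primrec.const c)).pair
        (Primrec.encode.comp (Primrec.snd.comp Primrec.fst))))
      (Primrec.option_some.comp (Primrec.encode.comp (Primrec.fst.comp Primrec.fst)))
  · have := @Nat.Partrec.Code.evaln_complete c (Encodable.encode x.2) (Encodable.encode x.1)
    simp only [Option.mem_def] at this
    rw [← this, hc]
    simp

theorem primrec_two_pow : Primrec fun n : ℕ => 2 ^ n := by
  refine (Primrec.nat_rec₁ 1 (f := fun _ m => 2 * m)
    (Primrec.nat_mul.comp (Primrec.const 2) Primrec.snd)).of_eq fun n => ?_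
  induction n with
  | zero => rfl
  | succ n ih => simp only [pow_succ']; rw [← ih]

theorem eBits_append_inj : ∀ {x x' y y' : List Bool},
    eBits x ++ y = eBits x' ++ y' → x = x' ∧ y = y'
  | [], [], _, _, h => by simpa [eBits] using h
  | [], b :: x', _, _, h => by cases b <;> simp [eBits] at h
  | b :: x, [], _, _, h => by cases b <;> simp [eBits] at h
  | b :: x, b' :: x', y, y', h => by
    have h' : b = b' ∧ eBits x ++ y = eBits x' ++ y' := by simpa [eBits] using h
    obtain ⟨rfl, rfl⟩ := eBits_append_inj h'.2
    exact ⟨by rw [h'.1], rfl⟩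

theorem ePair_inj {x x' y y' : List Bool} (h : ePair x y = ePair x' y') : x = x' ∧ y = y' :=
  eBits_append_inj h

theorem eList_injective : Function.Injective eList := by
  intro l l' h
  induction l generalizing l' with
  | nil => cases l' with
    | nil => rfl
    | cons x l' => simp [eList, eBits] at h
  | cons x l ih => cases l' with
    | nil => simp [eList, eBits] at h
    | cons x' l' =>
      obtain ⟨rfl, h2⟩ := eBits_append_inj (x := x) (x' := x') (y := eList l) (y' := eList l')
        (by simpa [eList] using h)
      rw [ih h2]

theorem encRectL_injective {ℓ : ℕ} : Function.Injective (encRectL (ℓ := ℓ)) := by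
  intro R R' h
  have h' := eList_injective h
  rw [List.map_inj_left] at h'
  exact funext fun i => eList_injective (h' i (List.mem_finRange i))

theorem length_eBits (x : List Bool) : (eBits x).length = 2 * x.length + 2 := by
  induction x with
  | nil => rfl
  | cons b x ih => simp [eBits] at ih ⊢; omega

theorem primrec_eBits : Primrec eBits := by
  have h : Primrec₂ fun (_ : List Bool) (b : Bool) => [b, b] :=
    Primrec.list_cons.comp Primrec.snd (Primrec.list_cons.comp Primrec.snd (Primrec.const []))
  exact Primrec.list_append.comp (Primrec.list_flatten.comp (Primrec.list_map Primrec.id h))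
    (Primrec.const [true, false])

theorem primrec_ePair : Primrec₂ ePair :=
  Primrec.list_append.comp (primrec_eBits.comp Primrec.fst) Primrec.snd

theorem primrec_eList : Primrec eList := by
  have h : Primrec₂ fun (_ : List (List Bool)) (x : List Bool) => eBits x :=
    primrec_eBits.comp Primrec.snd
  exact Primrec.list_flatten.comp (Primrec.list_map Primrec.id h)

theorem primrec_encRectL {ℓ : ℕ} : Primrec (encRectL (ℓ := ℓ)) := by
  have h : Primrec₂ fun (R : Fin ℓ → List (List Bool)) (i : Fin ℓ) => eList (R i) :=
    primrec_eList.comp (Primrec.fin_app.comp Primrec.fst Primrec.snd)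
  exact primrec_eList.comp (Primrec.list_map (Primrec.const (List.finRange ℓ)) h)

/-- The number with the given binary digits, least significant digit first. -/
def bitsVal (b : List Bool) : ℕ := b.foldr (fun c n => 2 * n + cond c 1 0) 0

theorem primrec_bitsVal : Primrec bitsVal := by
  have h : Primrec₂ fun (_ : List Bool) (x : Bool × ℕ) => 2 * x.2 + cond x.1 1 0 :=
    Primrec.nat_add.comp
      (Primrec.nat_mul.comp (Primrec.const 2) (Primrec.snd.comp Primrec.snd))
      (Primrec.cond (Primrec.fst.comp Primrec.snd) (Primrec.const 1) (Primrec.const 0))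
  exact Primrec.list_foldr Primrec.id (Primrec.const 0) h

theorem exists_bitsVal_eq (j n : ℕ) (h : n < 2 ^ j) :
    ∃ b : List Bool, b.length = j ∧ bitsVal b = n := by
  induction j generalizing n with
  | zero => exact ⟨[], rfl, by simp [bitsVal]; omega⟩
  | succ j ih =>
    obtain ⟨b, hb, hv⟩ := ih (n / 2) (by rw [pow_succ] at h; omega)
    refine ⟨decide (n % 2 = 1) :: b, by simp [hb], ?_⟩
    have : bitsVal (decide (n % 2 = 1) :: b) =
      2 * bitsVal b + cond (decide (n % 2 = 1)) 1 0 := rfl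
    rw [this, hv]
    rcases Nat.mod_two_eq_zero_or_one n with h0 | h0 <;> simp [h0] <;> omega

section Enumeration

variable {σ : Type}

open Classical in
/-- One step of `stageList`: the string decoded from the stage number is added if it is new. -/
noncomputable def stageStep (q : σ × List Bool × ℕ → Prop) (v : σ) (l : List (List Bool))
    (o : Option (List Bool × ℕ)) : List (List Bool) :=
  Option.casesOn o l fun x => if q (v, x) ∧ x.1 ∉ l then x.1 :: l else l

/-- The elements of `{z | ∃ n, q (v, z, n)}` found during the first stages, the latest first. -/
noncomputable def stageList (q : σ × List Bool × ℕ → Prop) (v : σ) : ℕ → List (List Bool)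
  | 0 => []
  | s + 1 => stageStep q v (stageList q v s) (Encodable.decode s)

theorem stageList_succ (q : σ × List Bool × ℕ → Prop) (v : σ) (s : ℕ) :
    stageList q v (s + 1) = stageList q v s ∨ ∃ x : List Bool × ℕ, q (v, x) ∧
      x.1 ∉ stageList q v s ∧ stageList q v (s + 1) = x.1 :: stageList q v s := by
  rw [stageList]
  cases Encodable.decode (α := List Bool × ℕ) s with
  | none => exact Or.inl rfl
  | some x =>
    by_cases hx : q (v, x) ∧ x.1 ∉ stageList q v s
    · exact Or.inr ⟨x, hx.1, hx.2, if_pos hx⟩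
    · exact Or.inl (if_neg hx)

theorem stageList_encode {q : σ × List Bool × ℕ → Prop} {v : σ} {x : List Bool × ℕ}
    (hq : q (v, x)) : x.1 ∈ stageList q v (Encodable.encode x + 1) := by
  rw [stageList, Encodable.encodek]
  by_cases hx : x.1 ∈ stageList q v (Encodable.encode x) <;> simp [stageStep, hq, hx]

theorem stageList_mem {q : σ × List Bool × ℕ → Prop} {v : σ} {s : ℕ} {z : List Bool}
    (hz : z ∈ stageList q v s) : ∃ n, q (v, z, n) := by
  induction s with
  | zero => simp [stageList] at hz
  | succ s ih =>
    obtain h | ⟨x, hx, -, h⟩ := stageList_succ q v s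
    · exact ih (h ▸ hz)
    · rw [h] at hz
      rcases List.mem_cons.1 hz with rfl | hz
      · exact ⟨_, hx⟩
      · exact ih hz

theorem stageList_nodup (q : σ × List Bool × ℕ → Prop) (v : σ) (s : ℕ) :
    (stageList q v s).Nodup := by
  induction s with
  | zero => simp [stageList]
  | succ s ih =>
    obtain h | ⟨x, -, hx, h⟩ := stageList_succ q v s
    · rwa [h]
    · rw [h]
      exact List.nodup_cons.2 ⟨hx, ih⟩

theorem stageList_suffix (q : σ × List Bool × ℕ → Prop) (v : σ) {s s' : ℕ} (h : s ≤ s') :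
    stageList q v s <:+ stageList q v s' := by
  induction h with
  | refl => exact List.suffix_refl _
  | step _ ih =>
    refine ih.trans ?_
    obtain h | ⟨x, -, -, h⟩ := stageList_succ q v _
    · rw [h]
    · rw [h]
      exact List.suffix_cons _ _

theorem stageList_eq_of_length (q : σ × List Bool × ℕ → Prop) (v : σ) {s s' : ℕ}
    (h : (stageList q v s).length = (stageList q v s').length) :
    stageList q v s = stageList q v s' := by
  rcases le_total s s' with hs | hs
  · exact (stageList_suffix q v hs).eq_of_length h
  · exact ((stageList_suffix q v hs).eq_of_length h.symm).symm

theorem exists_stageList_eq_cons {q : σ × List Bool × ℕ → Prop} {v : σ} {z : List Bool} {n : ℕ}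
    (hq : q (v, z, n)) : ∃ s l, stageList q v s = z :: l := by
  obtain ⟨s, hs⟩ : ∃ s, z ∈ stageList q v s := ⟨_, stageList_encode hq⟩
  induction s with
  | zero => simp [stageList] at hs
  | succ s ih =>
    obtain h | ⟨x, -, -, h⟩ := stageList_succ q v s
    · exact ih (h ▸ hs)
    · rw [h] at hs
      rcases List.mem_cons.1 hs with rfl | hs
      · exact ⟨_, _, h⟩
      · exact ih hs

theorem primrec_stageList [Primcodable σ] {q : σ × List Bool × ℕ → Prop} (hq : PrimrecPred q) :
    Primrec₂ (stageList q) := by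
  classical
  have h1 : PrimrecPred fun y : (σ × ℕ × List (List Bool)) × List Bool × ℕ => q (y.1.1, y.2) :=
    hq.comp ((Primrec.fst.comp Primrec.fst).pair Primrec.snd)
  have hl : Primrec fun y : (σ × ℕ × List (List Bool)) × List Bool × ℕ => y.1.2.2 :=
    Primrec.snd.comp (Primrec.snd.comp Primrec.fst)
  have hz : Primrec fun y : (σ × ℕ × List (List Bool)) × List Bool × ℕ => y.2.1 :=
    Primrec.fst.comp Primrec.snd
  have h2 : PrimrecPred fun y : (σ × ℕ × List (List Bool)) × List Bool × ℕ => y.2.1 ∈ y.1.2.2 :=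
    primrecRel_mem.comp hz hl
  have h3 : Primrec₂ fun (v : σ) (y : ℕ × List (List Bool)) =>
      stageStep q v y.2 (Encodable.decode y.1) :=
    Primrec.option_casesOn (Primrec.decode.comp (Primrec.fst.comp Primrec.snd))
      (Primrec.snd.comp Primrec.snd)
      (Primrec.ite (h1.and h2.not) (Primrec.list_cons.comp hz hl) hl)
  refine (Primrec.nat_rec (Primrec.const []) h3).of_eq fun v s => ?_
  induction s with
  | zero => rfl
  | succ s ih => rw [stageList, ← ih]

end Enumeration

theorem IsUniversal.KC_le {U V : Machine} (hU : IsUniversal U) (hV : Partrec₂ V) :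
    ∃ c, ∀ p u x, x ∈ V p u → KC U x u ≤ p.length + c := by
  obtain ⟨c, hc⟩ := hU.2 V hV
  refine ⟨c, fun p u x hx => ?_⟩
  obtain ⟨q, hq, hl⟩ := hc p u x hx
  have hmem : q.length ∈ { k | ∃ p : List Bool, p.length = k ∧ x ∈ U p u } := ⟨q, rfl, hq⟩
  exact (Nat.sInf_le hmem).trans hl

/-- `x` has a program of length at most `k` under the condition `u`. -/
def HasProg (U : Machine) (x u : List Bool) (k : ℕ) : Prop :=
  ∃ p : List Bool, p.length ≤ k ∧ x ∈ U p u

theorem partrec_print : Partrec₂ (fun p _ => Part.some p : Machine) :=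
  Computable.fst.partrec

theorem IsUniversal.exists_prog {U : Machine} (hU : IsUniversal U) (x u : List Bool) :
    HasProg U x u (KC U x u) := by
  obtain ⟨c, hc⟩ := hU.2 _ partrec_print
  obtain ⟨q, hq, -⟩ := hc x u x (Part.mem_some x)
  have hne : { k | ∃ p : List Bool, p.length = k ∧ x ∈ U p u }.Nonempty := ⟨_, q, rfl, hq⟩
  obtain ⟨p, hp, hx⟩ := Nat.sInf_mem hne
  exact ⟨p, hp.le, hx⟩

theorem sigmaPred_hasProg {U : Machine} (hU : IsUniversal U) :
    SigmaPred fun x : List Bool × List Bool × ℕ => HasProg U x.1 x.2.1 x.2.2 := by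
  refine SigmaPred.exists_snd (p := fun y : (List Bool × List Bool × ℕ) × List Bool =>
    y.2.length ≤ y.1.2.2 ∧ y.1.1 ∈ U y.2 y.1.2.1) (SigmaPred.and ?_ ?_)
  · exact SigmaPred.of_primrecPred (Primrec.nat_le.comp (Primrec.list_length.comp Primrec.snd)
      (Primrec.snd.comp (Primrec.snd.comp Primrec.fst)))
  · exact (sigmaPred_machine hU.1).comp ((Primrec.fst.comp Primrec.fst).pair
      (Primrec.snd.pair (Primrec.fst.comp (Primrec.snd.comp Primrec.fst))))

theorem exists_finset_bitLists (k : ℕ) : ∃ F : Finset (List Bool),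
    (∀ p : List Bool, p.length ≤ k → p ∈ F) ∧ F.card ≤ 2 ^ (k + 1) := by
  classical
  refine ⟨(Finset.range (k + 1)).biUnion fun i =>
    (Finset.univ : Finset (Fin i → Bool)).image List.ofFn, fun p hp => ?_, ?_⟩
  · simp only [Finset.mem_biUnion, Finset.mem_range, Finset.mem_image, Finset.mem_univ, true_and]
    exact ⟨p.length, by omega, p.get, List.ofFn_get p⟩
  · refine Finset.card_biUnion_le.trans ?_
    calc ∑ i ∈ Finset.range (k + 1),
          ((Finset.univ : Finset (Fin i → Bool)).image List.ofFn).card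
        ≤ ∑ i ∈ Finset.range (k + 1), 2 ^ i :=
          Finset.sum_le_sum fun i _ => Finset.card_image_le.trans (by simp)
      _ ≤ 2 ^ (k + 1) := by
          rw [Nat.geomSum_eq le_rfl]
          simp

theorem exists_finset_hasProg (U : Machine) (u : List Bool) (k : ℕ) :
    ∃ F : Finset (List Bool), (∀ x, x ∈ F ↔ HasProg U x u k) ∧ F.card ≤ 2 ^ (k + 1) := by
  classical
  obtain ⟨P, hP, hc⟩ := exists_finset_bitLists k
  let G : Finset (List Bool) := P.image fun p => if h : (U p u).Dom then (U p u).get h else []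
  refine ⟨G.filter fun x => HasProg U x u k, fun x => ?_, ?_⟩
  · simp only [Finset.mem_filter, and_iff_right_iff_imp]
    rintro ⟨p, hp, hx⟩
    exact Finset.mem_image.2 ⟨p, hP p hp, by
      rw [dif_pos (Part.dom_iff_mem.2 ⟨x, hx⟩)]; exact Part.get_eq_of_mem hx _⟩
  · exact (Finset.card_filter_le _ _).trans (Finset.card_image_le.trans hc)

theorem length_eList_le {l : List (List Bool)} {b : ℕ} (h : ∀ x ∈ l, x.length ≤ b) :
    (eList l).length ≤ l.length * (2 * b + 2) := by
  induction l with
  | nil => simp [eList]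
  | cons x l ih =>
    have h1 := ih fun y hy => h y (List.mem_cons_of_mem _ hy)
    have h2 := h x List.mem_cons_self
    have : eList (x :: l) = eBits x ++ eList l := rfl
    rw [this, List.length_append, length_eBits, List.length_cons, Nat.add_mul]
    omega

/-- An element of an enumerable set of at most `2 ^ j` strings has a description of length
about `j`, up to the cost of the parameters of the enumeration. -/
theorem IsUniversal.KC_le_of_sigmaPred {U : Machine} (hU : IsUniversal U)
    {E : List Bool × List ℕ × List Bool → Prop} (hE : SigmaPred E) (m : ℕ) :
    ∃ c, ∀ (u : List Bool) (a : List ℕ) (z : List Bool) (b j : ℕ) (F : Finset (List Bool)),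
      a.length = m → (∀ i ∈ a, i < 2 ^ b) → (∀ y, E (u, a, y) → y ∈ F) → F.card ≤ 2 ^ j →
      E (u, a, z) → KC U z u ≤ j + c * (b + 1) := by
  classical
  obtain ⟨q₀, hq₀, hE⟩ := hE
  let q : (List Bool × List ℕ) × List Bool × ℕ → Prop := fun x =>
    q₀ ((x.1.1, x.1.2, x.2.1), x.2.2)
  have hq : PrimrecPred q := hq₀.comp (((Primrec.fst.comp Primrec.fst).pair
    ((Primrec.snd.comp Primrec.fst).pair (Primrec.fst.comp Primrec.snd))).pair
    (Primrec.snd.comp Primrec.snd))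
  let D : List Bool → List (List Bool) × List Bool × ℕ → List (List Bool) := fun u x =>
    stageList q (u, x.1.map bitsVal) x.2.2
  have hD : Primrec₂ D := (primrec_stageList hq).comp
    (Primrec.fst.pair (Primrec.list_map (Primrec.fst.comp Primrec.snd)
      (primrec_bitsVal.comp Primrec.snd)))
    (Primrec.snd.comp (Primrec.snd.comp Primrec.snd))
  let C : List Bool × List Bool → List (List Bool) × List Bool × ℕ → Prop := fun v x =>
    v.1 = ePair (eList x.1) x.2.1 ∧ (D v.2 x).length = bitsVal x.2.1 + 1
  have hD' : Primrec₂ fun (v : List Bool × List Bool)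
      (x : List (List Bool) × List Bool × ℕ) => D v.2 x :=
    hD.comp (Primrec.snd.comp Primrec.fst) Primrec.snd
  have hC : PrimrecRel C := by
    refine PrimrecPred.and (Primrec.eq.comp (Primrec.fst.comp Primrec.fst)
      (primrec_ePair.comp (primrec_eList.comp (Primrec.fst.comp Primrec.snd))
        (Primrec.fst.comp (Primrec.snd.comp Primrec.snd)))) ?_
    exact Primrec.eq.comp (Primrec.list_length.comp hD') (Primrec.succ.comp
      (primrec_bitsVal.comp (Primrec.fst.comp (Primrec.snd.comp Primrec.snd))))
  let g : List Bool × List Bool → ℕ → Option (List Bool) := fun v n =>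
    (Encodable.decode (α := List (List Bool) × List Bool × ℕ) n).bind fun x =>
      if C v x then (D v.2 x).head? else none
  have hg : Primrec₂ g := by
    refine Primrec.option_bind (Primrec.decode.comp Primrec.snd) ?_
    have hC' : PrimrecPred fun y : ((List Bool × List Bool) × ℕ) ×
        List (List Bool) × List Bool × ℕ => C y.1.1 y.2 :=
      hC.comp (Primrec.fst.comp Primrec.fst) Primrec.snd
    exact Primrec.ite hC' (Primrec.list_head?.comp
      (hD'.comp (Primrec.fst.comp Primrec.fst) Primrec.snd)) (Primrec.const none)
  let V : Machine := fun p u => Nat.rfindOpt (g (p, u))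
  have hV : Partrec₂ V := Partrec.rfindOpt (f := g) hg.to_comp
  obtain ⟨c, hc⟩ := hU.KC_le hV
  refine ⟨4 * m + 2 + c, fun u a z b j F ha hb hF hj hz => ?_⟩
  have hbs : ∃ bs : List (List Bool), bs.length = m ∧ (∀ x ∈ bs, x.length ≤ b) ∧
      bs.map bitsVal = a := by
    subst ha
    clear hF hz
    induction a with
    | nil => exact ⟨[], by simp⟩
    | cons i a ih =>
      obtain ⟨bs, h1, h2, h3⟩ := ih fun i hi => hb i (List.mem_cons_of_mem _ hi)
      obtain ⟨x, hx, hi⟩ := exists_bitsVal_eq b i (hb i List.mem_cons_self)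
      exact ⟨x :: bs, by simp [h1], by simpa [hx] using h2, by simp [hi, h3]⟩
  obtain ⟨bs, hbm, hbl, hba⟩ := hbs
  obtain ⟨n, hn⟩ := (hE _).1 hz
  obtain ⟨s, l, hsl⟩ := exists_stageList_eq_cons (q := q) (v := (u, a)) (z := z) (n := n) hn
  have hlen : (z :: l).length ≤ 2 ^ j := by
    rw [← List.toFinset_card_of_nodup (hsl ▸ stageList_nodup q (u, a) s)]
    refine (Finset.card_le_card fun y hy => ?_).trans hj
    obtain ⟨k, hk⟩ := stageList_mem (hsl.symm ▸ List.mem_toFinset.1 hy : y ∈ stageList q (u, a) s)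
    exact hF y ((hE _).2 ⟨k, hk⟩)
  obtain ⟨idx, hidx, hval⟩ := exists_bitsVal_eq j l.length (by simpa using hlen)
  have hmem : z ∈ V (ePair (eList bs) idx) u := by
    have hdom : (V (ePair (eList bs) idx) u).Dom := by
      refine Nat.rfindOpt_dom.2 ⟨Encodable.encode (bs, idx, s), z, ?_⟩
      simp [g, C, D, hba, hsl, hval]
    obtain ⟨y, hy⟩ := Part.dom_iff_mem.1 hdom
    obtain ⟨k, hk⟩ := Nat.rfindOpt_spec hy
    obtain ⟨⟨bs', idx', s'⟩, -, hk⟩ := Option.bind_eq_some_iff.1 hk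
    split_ifs at hk with hCx
    obtain ⟨h1, h2⟩ := hCx
    obtain ⟨h3, rfl⟩ := ePair_inj h1
    obtain rfl := eList_injective h3
    simp only [D, hba] at h2 hk
    rw [stageList_eq_of_length q (u, a) (s' := s) (by rw [h2, hsl, hval]; rfl), hsl] at hk
    obtain rfl : z = y := by simpa using hk
    exact hy
  refine (hc _ _ _ hmem).trans ?_
  have h1 := length_eList_le hbl
  rw [ePair, List.length_append, length_eBits, hidx]
  rw [hbm] at h1
  nlinarith [Nat.zero_le (c * b)]

theorem primrec_getD_zero (i : ℕ) : Primrec fun a : List ℕ => a.getD i 0 :=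
  (Primrec.list_getD 0).comp Primrec.id (Primrec.const i)

/-- Symmetry of information, in the direction that requires a counting argument. -/
theorem IsUniversal.KC_add_KC_le {U : Machine} (hU : IsUniversal U) :
    ∃ c, ∀ (u z y : List Bool) (b : ℕ), KC U z u + KC U y (ePair z u) + 1 < 2 ^ b →
      KC U z (ePair y u) + KC U y u ≤ KC U z u + KC U y (ePair z u) + c * (b + 1) := by
  classical
  have hP := sigmaPred_hasProg hU
  have hE₁ : SigmaPred fun v : List Bool × List ℕ × List Bool => ∃ w : List Bool × List Bool,
      v.1 = ePair w.1 w.2 ∧ HasProg U v.2.2 w.2 (v.2.1.getD 0 0) ∧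
        HasProg U w.1 (ePair v.2.2 w.2) (v.2.1.getD 1 0) := by
    have hz : Primrec fun x : (List Bool × List ℕ × List Bool) × List Bool × List Bool =>
      x.1.2.2 := Primrec.snd.comp (Primrec.snd.comp Primrec.fst)
    have ha (i : ℕ) : Primrec fun x : (List Bool × List ℕ × List Bool) × List Bool × List Bool =>
      x.1.2.1.getD i 0 :=
        (primrec_getD_zero i).comp (Primrec.fst.comp (Primrec.snd.comp Primrec.fst))
    have hy : Primrec fun x : (List Bool × List ℕ × List Bool) × List Bool × List Bool =>
      x.2.1 := Primrec.fst.comp Primrec.snd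
    have hu : Primrec fun x : (List Bool × List ℕ × List Bool) × List Bool × List Bool =>
      x.2.2 := Primrec.snd.comp Primrec.snd
    have h1 := SigmaPred.of_primrecPred
      (Primrec.eq.comp (Primrec.fst.comp Primrec.fst) (primrec_ePair.comp hy hu))
    have h2 := hP.comp (hz.pair (hu.pair (ha 0)))
    have h3 := hP.comp (hy.pair ((primrec_ePair.comp hz hu).pair (ha 1)))
    exact (h1.and (h2.and h3)).exists_snd
  have hE₂ : SigmaPred fun v : List Bool × List ℕ × List Bool => ∃ l : List (List Bool),
      l.Nodup ∧ l.length = 2 ^ v.2.1.getD 2 0 ∧ ∀ z ∈ l, HasProg U z v.1 (v.2.1.getD 0 0) ∧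
        HasProg U v.2.2 (ePair z v.1) (v.2.1.getD 1 0) := by
    have hz : Primrec fun x : (List Bool × List ℕ × List Bool) × List Bool => x.2 := Primrec.snd
    have ha (i : ℕ) : Primrec fun x : (List Bool × List ℕ × List Bool) × List Bool =>
      x.1.2.1.getD i 0 :=
        (primrec_getD_zero i).comp (Primrec.fst.comp (Primrec.snd.comp Primrec.fst))
    have hy : Primrec fun x : (List Bool × List ℕ × List Bool) × List Bool => x.1.2.2 :=
      Primrec.snd.comp (Primrec.snd.comp Primrec.fst)
    have hu : Primrec fun x : (List Bool × List ℕ × List Bool) × List Bool => x.1.1 :=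
      Primrec.fst.comp Primrec.fst
    have h2 := hP.comp (hz.pair (hu.pair (ha 0)))
    have h3 := hP.comp (hy.pair ((primrec_ePair.comp hz hu).pair (ha 1)))
    exact (h2.and h3).exists_list
      (primrec_two_pow.comp ((primrec_getD_zero 2).comp (Primrec.fst.comp Primrec.snd)))
  obtain ⟨c₁, hc₁⟩ := hU.KC_le_of_sigmaPred hE₁ 2
  obtain ⟨c₂, hc₂⟩ := hU.KC_le_of_sigmaPred hE₂ 3
  refine ⟨c₁ + c₂ + 3, fun u z y b hb => ?_⟩
  have hzk := hU.exists_prog z u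
  have hys := hU.exists_prog y (ePair z u)
  set k := KC U z u
  set s := KC U y (ePair z u)
  obtain ⟨A, hA, hAc⟩ := exists_finset_hasProg U u k
  let N : List Bool → Finset (List Bool) := fun y => A.filter fun z => HasProg U y (ePair z u) s
  have hzN : z ∈ N y := Finset.mem_filter.2 ⟨(hA z).2 hzk, hys⟩
  have hN0 : (N y).card ≠ 0 := Finset.card_ne_zero_of_mem hzN
  set ν := Nat.log 2 (N y).card
  have hν : 2 ^ ν ≤ (N y).card := Nat.pow_log_le_self 2 hN0
  have hν' : (N y).card ≤ 2 ^ (ν + 1) := (Nat.lt_pow_succ_log_self one_lt_two _).le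
  have hνk : ν ≤ k + 1 :=
    (Nat.pow_le_pow_iff_right one_lt_two).1 (hν.trans ((Finset.card_filter_le _ _).trans hAc))
  have h1 : KC U z (ePair y u) ≤ ν + 1 + c₁ * (b + 1) := by
    refine hc₁ _ [k, s] z b (ν + 1) (N y) rfl ?_ ?_ hν' ⟨(y, u), rfl, hzk, hys⟩
    · simp only [List.mem_cons, List.not_mem_nil, or_false, forall_eq_or_imp, forall_eq]
      omega
    · rintro z' ⟨⟨y', u'⟩, he, h1, h2⟩
      obtain ⟨rfl, rfl⟩ := ePair_inj he
      exact Finset.mem_filter.2 ⟨(hA z').2 h1, h2⟩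
  choose B hB hBc using fun z => exists_finset_hasProg U (ePair z u) s
  let Y : Finset (List Bool) := (A.biUnion B).filter fun y => 2 ^ ν ≤ (N y).card
  have hY : Y.card ≤ 2 ^ (k + s + 2 - ν) := by
    have h := Finset.card_mul_le_card_mul (fun y z => HasProg U y (ePair z u) s) (s := Y) (t := A)
      (m := 2 ^ ν) (n := 2 ^ (s + 1)) (fun y hy => (Finset.mem_filter.1 hy).2) (fun z _ =>
        (Finset.card_le_card fun y hy => (hB z y).2 (Finset.mem_filter.1 hy).2).trans (hBc z))
    have h' : Y.card * 2 ^ ν ≤ 2 ^ (k + s + 2 - ν) * 2 ^ ν := by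
      refine h.trans ((Nat.mul_le_mul_right _ hAc).trans ?_)
      rw [← pow_add, ← pow_add]
      exact Nat.pow_le_pow_right two_pos (by omega)
    exact Nat.le_of_mul_le_mul_right h' (by positivity)
  have h2 : KC U y u ≤ k + s + 2 - ν + c₂ * (b + 1) := by
    refine hc₂ u [k, s, ν] y b _ Y rfl ?_ ?_ hY ?_
    · simp only [List.mem_cons, List.not_mem_nil, or_false, forall_eq_or_imp, forall_eq]
      omega
    · rintro y' ⟨l, hl, hlen, hmem⟩
      have hsub : l.toFinset ⊆ N y' := fun z' hz' => by
        obtain ⟨h1, h2⟩ := hmem z' (List.mem_toFinset.1 hz')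
        exact Finset.mem_filter.2 ⟨(hA z').2 h1, h2⟩
      have hpow : 2 ^ ν ≤ (N y').card := by
        refine le_trans ?_ (Finset.card_le_card hsub)
        rw [List.toFinset_card_of_nodup hl, hlen]
        rfl
      obtain ⟨z', hz'⟩ := Finset.card_pos.1 (lt_of_lt_of_le (by positivity) hpow)
      obtain ⟨h1, h2⟩ := Finset.mem_filter.1 hz'
      exact Finset.mem_filter.2 ⟨Finset.mem_biUnion.2 ⟨z', h1, (hB z' y').2 h2⟩, hpow⟩
    · obtain ⟨T, hT, hTc⟩ := Finset.exists_subset_card_eq hν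
      refine ⟨T.toList, T.nodup_toList, by simp [hTc], fun z' hz' => ?_⟩
      obtain ⟨h1, h2⟩ := Finset.mem_filter.1 (hT (Finset.mem_toList.1 hz'))
      exact ⟨(hA z').1 h1, h2⟩
  have h3 : (c₁ + c₂ + 3) * (b + 1) = c₁ * (b + 1) + c₂ * (b + 1) + 3 * b + 3 := by ring
  omega

theorem mem_allBV {n : ℕ} {x : List Bool} : x ∈ allBV n ↔ x.length = n := by
  induction n generalizing x with
  | zero => simp [allBV]
  | succ n ih => cases x with
    | nil => simp [allBV]
    | cons b x => cases b <;> simp [allBV, ih]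

theorem length_allBV (n : ℕ) : (allBV n).length = 2 ^ n := by
  induction n with
  | zero => rfl
  | succ n ih => simp [allBV, ih, pow_succ]

namespace MProtocol

variable {ℓ : ℕ} {nn : Fin ℓ → ℕ} (P : MProtocol ℓ nn)

/-- The rectangles selected by the transcript function, in the order of the encoding. -/
noncomputable def transList : List (Fin ℓ → List (List Bool)) :=
  (Fintype.piFinset fun i : Fin ℓ => (allBV (nn i)).toFinset).toList.map P.trans

theorem encMProt_eq :
    encMProt P = ePair (eList (P.rects.map encRectL)) (eList (P.transList.map encRectL)) := by
  simp [encMProt, transList, Function.comp_def]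

theorem trans_mem_transList {x : Fin ℓ → List Bool} (hx : ∀ i, (x i).length = nn i) :
    P.trans x ∈ P.transList :=
  List.mem_map.2 ⟨x, by simpa [mem_allBV] using hx, rfl⟩

theorem mem_rects_of_mem_transList {R : Fin ℓ → List (List Bool)} (hR : R ∈ P.transList) :
    R ∈ P.rects := by
  obtain ⟨x, hx, rfl⟩ := List.mem_map.1 hR
  exact P.trans_mem x (by simpa [mem_allBV] using hx)

theorem length_transList_le : P.transList.length ≤ 2 ^ ∑ i, nn i := by
  rw [transList, List.length_map, Finset.length_toList, Fintype.card_piFinset,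
    ← Finset.prod_pow_eq_pow_sum]
  exact Finset.prod_le_prod' fun i _ =>
    (List.toFinset_card_le _).trans (length_allBV (nn i)).le

theorem card_filter_transList_le (x : Fin ℓ → List Bool) :
    (P.transList.toFinset.filter fun R => ∀ i, x i ∈ R i).card ≤ cellThickL P x := by
  rw [cellThickL, List.countP_eq_length_filter]
  refine (Finset.card_le_card fun R hR => ?_).trans (List.toFinset_card_le _)
  obtain ⟨h1, h2⟩ := Finset.mem_filter.1 hR
  simpa using ⟨P.mem_rects_of_mem_transList (List.mem_toFinset.1 h1), h2⟩

end MProtocol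

theorem primrecRel_forall_mem {ℓ : ℕ} :
    PrimrecRel fun (x : Fin ℓ → List Bool) (R : Fin ℓ → List (List Bool)) => ∀ i, x i ∈ R i := by
  have h1 : PrimrecRel fun (i : Fin ℓ) (y : (Fin ℓ → List Bool) × (Fin ℓ → List (List Bool))) =>
      y.1 i ∈ y.2 i :=
    primrecRel_mem.comp (Primrec.fin_app.comp (Primrec.fst.comp Primrec.snd) Primrec.fst)
      (Primrec.fin_app.comp (Primrec.snd.comp Primrec.snd) Primrec.fst)
  have h2 : PrimrecPred fun y : (Fin ℓ → List Bool) × (Fin ℓ → List (List Bool)) =>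
      ∀ i ∈ List.finRange ℓ, y.1 i ∈ y.2 i :=
    h1.forall_mem_list.comp (Primrec.const (List.finRange ℓ)) Primrec.id
  exact h2.of_eq fun y => by simp

/-- At most `N` distinct rectangles of the list contain the cell `x`. -/
def AtMostThick {ℓ : ℕ} (L : List (Fin ℓ → List (List Bool))) (x : Fin ℓ → List Bool) (N : ℕ) :
    Prop :=
  ∃ L' : List (Fin ℓ → List (List Bool)), L'.length ≤ N ∧
    ∀ R ∈ L, (¬ ∀ i, x i ∈ R i) ∨ R ∈ L'

theorem sigmaPred_atMostThick {ℓ : ℕ} :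
    SigmaPred fun v : List (Fin ℓ → List (List Bool)) × (Fin ℓ → List Bool) × ℕ =>
      AtMostThick v.1 v.2.1 v.2.2 := by
  refine SigmaPred.exists_snd (p := fun w : (List (Fin ℓ → List (List Bool)) ×
    (Fin ℓ → List Bool) × ℕ) × List (Fin ℓ → List (List Bool)) => w.2.length ≤ w.1.2.2 ∧
      ∀ R ∈ w.1.1, (¬ ∀ i, w.1.2.1 i ∈ R i) ∨ R ∈ w.2) (SigmaPred.and ?_ ?_)
  · exact SigmaPred.of_primrecPred (Primrec.nat_le.comp (Primrec.list_length.comp Primrec.snd)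
      (Primrec.snd.comp (Primrec.snd.comp Primrec.fst)))
  · refine SigmaPred.forall_mem (p := fun y : ((List (Fin ℓ → List (List Bool)) ×
      (Fin ℓ → List Bool) × ℕ) × List (Fin ℓ → List (List Bool))) × (Fin ℓ → List (List Bool)) =>
        (¬ ∀ i, y.1.1.2.1 i ∈ y.2 i) ∨ y.2 ∈ y.1.2)
        (SigmaPred.of_primrecPred (PrimrecPred.or (PrimrecPred.not ?_) ?_))
        (Primrec.fst.comp Primrec.fst)
    · exact primrecRel_forall_mem.comp
        (Primrec.fst.comp (Primrec.snd.comp (Primrec.fst.comp Primrec.fst))) Primrec.snd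
    · exact primrecRel_mem.comp Primrec.snd (Primrec.snd.comp Primrec.fst)

theorem AtMostThick.card_le {ℓ : ℕ} {L : List (Fin ℓ → List (List Bool))} {x : Fin ℓ → List Bool}
    {N : ℕ} (h : AtMostThick L x N) : (L.toFinset.filter fun R => ∀ i, x i ∈ R i).card ≤ N := by
  obtain ⟨L', hL', hmem⟩ := h
  refine (Finset.card_le_card fun R hR => ?_).trans ((List.toFinset_card_le L').trans hL')
  obtain ⟨h1, h2⟩ := Finset.mem_filter.1 hR
  exact List.mem_toFinset.2 ((hmem R (List.mem_toFinset.1 h1)).resolve_left (not_not.2 h2))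

theorem atMostThick_of_card_le {ℓ : ℕ} {L : List (Fin ℓ → List (List Bool))}
    {x : Fin ℓ → List Bool} {N : ℕ}
    (h : (L.toFinset.filter fun R => ∀ i, x i ∈ R i).card ≤ N) : AtMostThick L x N := by
  refine ⟨(L.toFinset.filter fun R => ∀ i, x i ∈ R i).toList, by simpa using h, fun R hR => ?_⟩
  by_cases hx : ∀ i, x i ∈ R i
  · exact Or.inr (by simpa using ⟨hR, hx⟩)
  · exact Or.inl hx

/-- The transcript has complexity at most the total length of the inputs. -/
theorem IsUniversal.KC_trans_le {U : Machine} (hU : IsUniversal U) :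
    ∃ c, ∀ (ℓ : ℕ) (nn : Fin ℓ → ℕ) (P : MProtocol ℓ nn) (x : Fin ℓ → List Bool),
      (∀ i, (x i).length = nn i) → KC U (encRectL (P.trans x)) (encMProt P) ≤ ∑ i, nn i + c := by
  classical
  have hE : SigmaPred fun v : List Bool × List ℕ × List Bool =>
      ∃ w : List Bool × List (List Bool), v.1 = ePair w.1 (eList w.2) ∧ v.2.2 ∈ w.2 := by
    refine SigmaPred.exists_snd (p := fun y : (List Bool × List ℕ × List Bool) × List Bool ×
      List (List Bool) => y.1.1 = ePair y.2.1 (eList y.2.2) ∧ y.1.2.2 ∈ y.2.2)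
      (SigmaPred.of_primrecPred (PrimrecPred.and ?_ ?_))
    · exact Primrec.eq.comp (Primrec.fst.comp Primrec.fst) (primrec_ePair.comp
        (Primrec.fst.comp Primrec.snd)
        (primrec_eList.comp (Primrec.snd.comp Primrec.snd)))
    · exact primrecRel_mem.comp (Primrec.snd.comp (Primrec.snd.comp Primrec.fst))
        (Primrec.snd.comp Primrec.snd)
  obtain ⟨c, hc⟩ := hU.KC_le_of_sigmaPred hE 0
  refine ⟨c, fun ℓ nn P x hx => ?_⟩
  have := hc (encMProt P) [] (encRectL (P.trans x)) 0 (∑ i, nn i)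
    (P.transList.map encRectL).toFinset rfl (by simp) ?_ ?_
    ⟨(eList (P.rects.map encRectL), P.transList.map encRectL), P.encMProt_eq,
      List.mem_map_of_mem (P.trans_mem_transList hx)⟩
  · simpa using this
  · rintro y ⟨⟨w₁, w₂⟩, he, hy⟩
    obtain ⟨-, h2⟩ := ePair_inj (P.encMProt_eq.symm.trans he)
    exact List.mem_toFinset.2 (eList_injective h2 ▸ hy)
  · exact (List.toFinset_card_le _).trans (by simpa using P.length_transList_le)

/-- A string in the side of a rectangle is determined by its index among the simple ones. -/
theorem IsUniversal.KC_side_le {U : Machine} (hU : IsUniversal U) {ℓ : ℕ} (i : Fin ℓ) :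
    ∃ c, ∀ (u : List Bool) (R : Fin ℓ → List (List Bool)) (y : List Bool) (m b j : ℕ)
      (F : Finset (List Bool)), m < 2 ^ b → y ∈ R i → HasProg U y u m →
      (∀ y' ∈ R i, HasProg U y' u m → y' ∈ F) → F.card ≤ 2 ^ j →
      KC U y (ePair (encRectL R) u) ≤ j + c * (b + 1) := by
  have hE : SigmaPred fun v : List Bool × List ℕ × List Bool =>
      ∃ w : (Fin ℓ → List (List Bool)) × List Bool, v.1 = ePair (encRectL w.1) w.2 ∧
        v.2.2 ∈ w.1 i ∧ HasProg U v.2.2 w.2 (v.2.1.getD 0 0) := by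
    have hy : Primrec fun x : (List Bool × List ℕ × List Bool) ×
        (Fin ℓ → List (List Bool)) × List Bool => x.1.2.2 :=
      Primrec.snd.comp (Primrec.snd.comp Primrec.fst)
    have ha : Primrec fun x : (List Bool × List ℕ × List Bool) ×
        (Fin ℓ → List (List Bool)) × List Bool => x.1.2.1.getD 0 0 :=
      (primrec_getD_zero 0).comp (Primrec.fst.comp (Primrec.snd.comp Primrec.fst))
    have hR : Primrec fun x : (List Bool × List ℕ × List Bool) ×
        (Fin ℓ → List (List Bool)) × List Bool => x.2.1 := Primrec.fst.comp Primrec.snd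
    have hu : Primrec fun x : (List Bool × List ℕ × List Bool) ×
        (Fin ℓ → List (List Bool)) × List Bool => x.2.2 := Primrec.snd.comp Primrec.snd
    have h1 := SigmaPred.of_primrecPred (Primrec.eq.comp (Primrec.fst.comp Primrec.fst)
      (primrec_ePair.comp (primrec_encRectL.comp hR) hu))
    have h2 := SigmaPred.of_primrecPred
      (primrecRel_mem.comp hy (Primrec.fin_app.comp hR (Primrec.const i)))
    have h3 := (sigmaPred_hasProg hU).comp (hy.pair (hu.pair ha))
    exact (h1.and (h2.and h3)).exists_snd
  obtain ⟨c, hc⟩ := hU.KC_le_of_sigmaPred hE 1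
  refine ⟨c, fun u R y m b j F hm hy hp hF hj => ?_⟩
  refine hc _ [m] y b j F rfl (by simpa using hm) ?_ hj ⟨(R, u), rfl, hy, hp⟩
  rintro y' ⟨⟨R', u'⟩, he, h1, h2⟩
  obtain ⟨h3, rfl⟩ := ePair_inj he
  obtain rfl := encRectL_injective h3
  exact hF y' h1 h2

/-- A transcript is determined by its index among the rectangles with many thin simple cells. -/
theorem IsUniversal.KC_rect_le {U : Machine} (hU : IsUniversal U) (ℓ : ℕ) :
    ∃ c, ∀ (v : List Bool) (L : List (Fin ℓ → List (List Bool)))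
      (R : Fin ℓ → List (List Bool)) (m : Fin ℓ → ℕ) (τ r b j : ℕ)
      (G : Finset (Fin ℓ → List (List Bool))) (S : Finset (Fin ℓ → List Bool)),
      (∀ i, m i < 2 ^ b) → τ < 2 ^ b → r < 2 ^ b → R ∈ L → 2 ^ τ ≤ S.card →
      (∀ x ∈ S, (∀ i, x i ∈ R i) ∧ (∀ i, HasProg U (x i) (ePair v (eList (L.map encRectL))) (m i)) ∧
        AtMostThick L x (2 ^ r)) →
      (∀ R' ∈ L, ∀ S' : Finset (Fin ℓ → List Bool), S'.card = 2 ^ τ →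
        (∀ x ∈ S', (∀ i, x i ∈ R' i) ∧
          (∀ i, HasProg U (x i) (ePair v (eList (L.map encRectL))) (m i)) ∧
          AtMostThick L x (2 ^ r)) → R' ∈ G) →
      G.card ≤ 2 ^ j →
      KC U (encRectL R) (ePair v (eList (L.map encRectL))) ≤ j + c * (b + 1) := by
  classical
  let Cond : (List Bool × List ℕ × List Bool) × List Bool × List (Fin ℓ → List (List Bool)) ×
      (Fin ℓ → List (List Bool)) → (Fin ℓ → List Bool) → Prop := fun y x =>
    (∀ i, x i ∈ y.2.2.2 i) ∧
      (∀ i ∈ List.finRange ℓ, HasProg U (x i) y.1.1 (y.1.2.1.getD (i + 2) 0)) ∧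
      AtMostThick y.2.2.1 x (2 ^ y.1.2.1.getD 1 0)
  have hCond : SigmaPred fun w : ((List Bool × List ℕ × List Bool) × List Bool ×
      List (Fin ℓ → List (List Bool)) × (Fin ℓ → List (List Bool))) × (Fin ℓ → List Bool) =>
      Cond w.1 w.2 := by
    refine SigmaPred.and ?_ (SigmaPred.and ?_ ?_)
    · exact SigmaPred.of_primrecPred (primrecRel_forall_mem.comp Primrec.snd
        (Primrec.snd.comp (Primrec.snd.comp (Primrec.snd.comp Primrec.fst))))
    · refine SigmaPred.forall_mem (p := fun q : (((List Bool × List ℕ × List Bool) × List Bool ×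
        List (Fin ℓ → List (List Bool)) × (Fin ℓ → List (List Bool))) × (Fin ℓ → List Bool)) ×
        Fin ℓ => HasProg U (q.1.2 q.2) q.1.1.1.1 (q.1.1.1.2.1.getD (q.2 + 2) 0)) ?_
        (Primrec.const (List.finRange ℓ))
      refine (sigmaPred_hasProg hU).comp (Primrec.pair ?_ (Primrec.pair ?_ ?_))
      · exact Primrec.fin_app.comp (Primrec.snd.comp Primrec.fst) Primrec.snd
      · exact Primrec.fst.comp (Primrec.fst.comp (Primrec.fst.comp Primrec.fst))
      · exact (Primrec.list_getD 0).comp (Primrec.fst.comp (Primrec.snd.comp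
          (Primrec.fst.comp (Primrec.fst.comp Primrec.fst))))
          (Primrec.nat_add.comp (Primrec.fin_val.comp Primrec.snd) (Primrec.const 2))
    · refine sigmaPred_atMostThick.comp (Primrec.pair ?_ (Primrec.pair Primrec.snd ?_))
      · exact Primrec.fst.comp (Primrec.snd.comp (Primrec.snd.comp Primrec.fst))
      · exact primrec_two_pow.comp ((primrec_getD_zero 1).comp
          (Primrec.fst.comp (Primrec.snd.comp (Primrec.fst.comp Primrec.fst))))
  have hE : SigmaPred fun w : List Bool × List ℕ × List Bool =>
      ∃ y : List Bool × List (Fin ℓ → List (List Bool)) × (Fin ℓ → List (List Bool)),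
        (w.1 = ePair y.1 (eList (y.2.1.map encRectL)) ∧ y.2.2 ∈ y.2.1 ∧
          w.2.2 = encRectL y.2.2) ∧
        ∃ l : List (Fin ℓ → List Bool), l.Nodup ∧ l.length = 2 ^ w.2.1.getD 0 0 ∧
          ∀ x ∈ l, Cond (w, y) x := by
    refine SigmaPred.exists_snd (p := fun q : (List Bool × List ℕ × List Bool) × List Bool ×
      List (Fin ℓ → List (List Bool)) × (Fin ℓ → List (List Bool)) =>
        (q.1.1 = ePair q.2.1 (eList (q.2.2.1.map encRectL)) ∧ q.2.2.2 ∈ q.2.2.1 ∧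
          q.1.2.2 = encRectL q.2.2.2) ∧
        ∃ l : List (Fin ℓ → List Bool), l.Nodup ∧ l.length = 2 ^ q.1.2.1.getD 0 0 ∧
          ∀ x ∈ l, Cond q x)
      (SigmaPred.and (SigmaPred.of_primrecPred (PrimrecPred.and ?_ (PrimrecPred.and ?_ ?_))) ?_)
    · exact Primrec.eq.comp (Primrec.fst.comp Primrec.fst) (primrec_ePair.comp
        (Primrec.fst.comp Primrec.snd) (primrec_eList.comp
          (Primrec.list_map (Primrec.fst.comp (Primrec.snd.comp Primrec.snd))
            (primrec_encRectL.comp Primrec.snd))))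
    · exact primrecRel_mem.comp (Primrec.snd.comp (Primrec.snd.comp Primrec.snd))
        (Primrec.fst.comp (Primrec.snd.comp Primrec.snd))
    · exact Primrec.eq.comp (Primrec.snd.comp (Primrec.snd.comp Primrec.fst))
        (primrec_encRectL.comp (Primrec.snd.comp (Primrec.snd.comp Primrec.snd)))
    · exact hCond.exists_list (primrec_two_pow.comp ((primrec_getD_zero 0).comp
        (Primrec.fst.comp (Primrec.snd.comp Primrec.fst))))
  obtain ⟨c, hc⟩ := hU.KC_le_of_sigmaPred hE (ℓ + 2)
  refine ⟨c, fun v L R m τ r b j G S hm hτ hr hR hS hSmem hG hj => ?_⟩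
  have hget (i : Fin ℓ) : (τ :: r :: List.ofFn m).getD (i + 2) 0 = m i := by simp
  refine hc _ (τ :: r :: List.ofFn m) _ b j (G.image encRectL) (by simp) ?_ ?_
    (Finset.card_image_le.trans hj) ?_
  · simp only [List.mem_cons, List.mem_ofFn', Set.mem_range]
    rintro k (rfl | rfl | ⟨i, rfl⟩)
    exacts [hτ, hr, hm i]
  · rintro z ⟨⟨v', L', R'⟩, ⟨he, hR', rfl⟩, l, hl, hlen, hmem⟩
    obtain ⟨rfl, h2⟩ := ePair_inj he
    obtain rfl := List.map_injective_iff.2 encRectL_injective (eList_injective h2)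
    refine Finset.mem_image_of_mem _ (hG R' hR' l.toFinset ?_ fun x hx => ?_)
    · rw [List.toFinset_card_of_nodup hl, hlen]
      rfl
    · obtain ⟨h1, h2, h3⟩ := hmem x (List.mem_toFinset.1 hx)
      exact ⟨h1, fun i => hget i ▸ h2 i (List.mem_finRange i), h3⟩
  · obtain ⟨T, hT, hTc⟩ := Finset.exists_subset_card_eq hS
    refine ⟨(v, L, R), ⟨rfl, hR, rfl⟩, T.toList, T.nodup_toList, by simp [hTc], fun x hx => ?_⟩
    obtain ⟨h1, h2, h3⟩ := hSmem x (hT (Finset.mem_toList.1 hx))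
    exact ⟨h1, fun i _ => (hget i).symm ▸ h2 i, h3⟩

theorem exists_lt_two_pow_log_add (A C : ℕ) : ∃ e, ∀ n, A * n + C < 2 ^ (Nat.log 2 n + e) := by
  refine ⟨A + C + 1, fun n => ?_⟩
  have h1 : n + 1 ≤ 2 ^ (Nat.log 2 n + 1) := Nat.lt_pow_succ_log_self one_lt_two n
  have h2 : A + C < 2 ^ (A + C) := Nat.lt_two_pow_self
  calc A * n + C ≤ (A + C) * (n + 1) := by nlinarith
    _ < 2 ^ (A + C) * (n + 1) := by gcongr
    _ ≤ 2 ^ (A + C) * 2 ^ (Nat.log 2 n + 1) := by gcongr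
    _ = _ := by ring

/-- Double counting of the pairs of a cell and a rectangle containing it. -/
theorem card_mul_le_of_atMostThick {ℓ : ℕ} {L : List (Fin ℓ → List (List Bool))}
    {cells : Finset (Fin ℓ → List Bool)} {G : Finset (Fin ℓ → List (List Bool))} {K N : ℕ}
    (hG : ∀ R ∈ G, R ∈ L ∧ K ≤ (cells.filter fun x => ∀ i, x i ∈ R i).card)
    (hN : ∀ x ∈ cells, AtMostThick L x N) : G.card * K ≤ cells.card * N := by
  refine Finset.card_mul_le_card_mul
    (fun (R : Fin ℓ → List (List Bool)) (x : Fin ℓ → List Bool) => ∀ i, x i ∈ R i)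
    (fun R hR => (hG R hR).2) fun x hx => le_trans (Finset.card_le_card fun R hR => ?_)
      (hN x hx).card_le
  obtain ⟨h1, h2⟩ := Finset.mem_filter.1 hR
  exact Finset.mem_filter.2 ⟨List.mem_toFinset.2 (hG R h1).1, h2⟩

namespace IsUniversal

variable {U : Machine}

/-- A transcript all of whose sides contain many simple strings is itself simple. -/
theorem KC_trans_add_log_le (hU : IsUniversal U) (ℓ : ℕ) :
    ∃ c, ∀ (nn : Fin ℓ → ℕ) (P : MProtocol ℓ nn) (x : Fin ℓ → List Bool) (b r : ℕ)
      (m : Fin ℓ → ℕ) (Y : Fin ℓ → Finset (List Bool)),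
      (∀ i, (x i).length = nn i) → (∀ i, m i < 2 ^ b) → ∑ i, nn i < 2 ^ b →
      (∀ i s, s ∈ Y i ↔ s ∈ P.trans x i ∧ HasProg U s (encMProt P) (m i)) →
      (∀ i, x i ∈ Y i) → rectThickL P (P.trans x) ≤ 2 ^ r →
      KC U (encRectL (P.trans x)) (encMProt P) + ∑ i, Nat.log 2 (Y i).card ≤
        ∑ i, (m i + 1) + r + c * (b + 1) := by
  classical
  obtain ⟨c, hc⟩ := hU.KC_rect_le ℓ
  refine ⟨c, fun nn P x b r m Y hx hm hb hY hxY hr => ?_⟩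
  choose X hX hXc using fun i => exists_finset_hasProg U (encMProt P) (m i)
  have hlog i : 2 ^ Nat.log 2 (Y i).card ≤ (Y i).card :=
    Nat.pow_log_le_self 2 (Finset.card_ne_zero_of_mem (hxY i))
  have hYn i : (Y i).card ≤ 2 ^ nn i := by
    refine le_trans (Finset.card_le_card fun s hs => ?_)
      ((List.toFinset_card_le (allBV (nn i))).trans (length_allBV (nn i)).le)
    exact List.mem_toFinset.2 (mem_allBV.2
      (P.sides_len _ (P.trans_mem x hx) i s ((hY i s).1 hs).1))
  have hlogn i : Nat.log 2 (Y i).card ≤ nn i :=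
    (Nat.pow_le_pow_iff_right one_lt_two).1 ((hlog i).trans (hYn i))
  set σ := ∑ i, Nat.log 2 (Y i).card with hσ
  have hσb : σ ≤ ∑ i, nn i := Finset.sum_le_sum fun i _ => hlogn i
  set r' := min r (∑ i, nn i) with hr'
  set L := P.transList with hL
  let cells := (Fintype.piFinset X).filter fun x => AtMostThick L x (2 ^ r')
  let G := L.toFinset.filter fun R => 2 ^ σ ≤ (cells.filter fun x => ∀ i, x i ∈ R i).card
  have hcells : cells.card ≤ 2 ^ ∑ i, (m i + 1) := by
    refine (Finset.card_filter_le _ _).trans ?_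
    rw [Fintype.card_piFinset, ← Finset.prod_pow_eq_pow_sum]
    exact Finset.prod_le_prod' fun i _ => hXc i
  have hGc : G.card * 2 ^ σ ≤ 2 ^ (∑ i, (m i + 1) + r') := by
    rw [pow_add]
    refine (card_mul_le_of_atMostThick (L := L) (fun R hR => ?_) fun x hx => ?_).trans
      (Nat.mul_le_mul_right _ hcells)
    · exact ⟨List.mem_toFinset.1 (Finset.mem_filter.1 hR).1, (Finset.mem_filter.1 hR).2⟩
    · exact (Finset.mem_filter.1 hx).2
  have hmemG (R : Fin ℓ → List (List Bool)) (hR : R ∈ L) (S : Finset (Fin ℓ → List Bool))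
      (hS : 2 ^ σ ≤ S.card)
      (h : ∀ y ∈ S, (∀ i, y i ∈ R i) ∧ (∀ i, HasProg U (y i) (encMProt P) (m i)) ∧
        AtMostThick L y (2 ^ r')) : R ∈ G := by
    refine Finset.mem_filter.2 ⟨List.mem_toFinset.2 hR, hS.trans (Finset.card_le_card ?_)⟩
    intro y hy
    obtain ⟨h1, h2, h3⟩ := h y hy
    exact Finset.mem_filter.2 ⟨Finset.mem_filter.2
      ⟨Fintype.mem_piFinset.2 fun i => (hX i _).2 (h2 i), h3⟩, h1⟩
  have hSc : 2 ^ σ ≤ (Fintype.piFinset Y).card := by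
    rw [Fintype.card_piFinset, hσ, ← Finset.prod_pow_eq_pow_sum]
    exact Finset.prod_le_prod' fun i _ => hlog i
  have hSmem : ∀ y ∈ Fintype.piFinset Y, (∀ i, y i ∈ P.trans x i) ∧
      (∀ i, HasProg U (y i) (encMProt P) (m i)) ∧ AtMostThick L y (2 ^ r') := by
    intro y hy
    have h i := (hY i _).1 (Fintype.mem_piFinset.1 hy i)
    refine ⟨fun i => (h i).1, fun i => (h i).2, atMostThick_of_card_le ?_⟩
    rw [hr']
    rcases min_choice r (∑ i, nn i) with he | he <;> rw [he]
    · refine (P.card_filter_transList_le y).trans (le_trans ?_ hr)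
      exact Finset.le_sup (f := cellThickL P)
        (Fintype.mem_piFinset.2 fun i => List.mem_toFinset.2 (h i).1)
    · exact (Finset.card_filter_le _ _).trans
        ((List.toFinset_card_le _).trans P.length_transList_le)
  have htG := hmemG _ (P.trans_mem_transList hx) _ hSc hSmem
  have hσle : σ ≤ ∑ i, (m i + 1) + r' := by
    refine (Nat.pow_le_pow_iff_right one_lt_two).1 (le_trans ?_ hGc)
    exact Nat.le_mul_of_pos_left _ (Finset.card_pos.2 ⟨_, htG⟩)
  have hGj : G.card ≤ 2 ^ (∑ i, (m i + 1) + r' - σ) := by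
    refine Nat.le_of_mul_le_mul_right (hGc.trans ?_) (Nat.two_pow_pos σ)
    rw [← pow_add, Nat.sub_add_cancel hσle]
  rw [P.encMProt_eq, ← hL] at hmemG hSmem ⊢
  have := hc (eList (P.rects.map encRectL)) L (P.trans x) m σ r' b _ G _ hm (hσb.trans_lt hb)
    ((min_le_right _ _).trans_lt hb) (P.trans_mem_transList hx) hSc hSmem
    (fun R hR S hS h => hmemG R hR S hS.ge h) hGj
  have hrr : r' ≤ r := min_le_left _ _
  omega

theorem KC_le_length_add (hU : IsUniversal U) : ∃ c, ∀ x u, KC U x u ≤ x.length + c := by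
  obtain ⟨c, hc⟩ := hU.KC_le partrec_print
  exact ⟨c, fun x u => hc x u x (Part.mem_some x)⟩

/-- The main inequality, with an error term measured by the bit length of `n`. -/
theorem sum_KC_trans_le (hU : IsUniversal U) (ℓ : ℕ) :
    ∃ K, ∀ (nn : Fin ℓ → ℕ) (P : MProtocol ℓ nn) (x : Fin ℓ → List Bool),
      (∀ i, (x i).length = nn i) →
      ∑ i, KC U (encRectL (P.trans x)) (ePair (x i) (encMProt P)) +
          KC U (encRectL (P.trans x)) (encMProt P) ≤
        ℓ * KC U (encRectL (P.trans x)) (encMProt P) + Nat.log 2 (rectThickL P (P.trans x)) +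
          K * (Nat.log 2 (Finset.univ.sup nn) + 1) := by
  classical
  obtain ⟨cp, hcp⟩ := hU.KC_le_length_add
  obtain ⟨c₀, hc₀⟩ := hU.KC_trans_le
  obtain ⟨c, hc⟩ := hU.KC_add_KC_le
  choose c₁ hc₁ using fun i : Fin ℓ => hU.KC_side_le i
  obtain ⟨c₂, hc₂⟩ := hU.KC_trans_add_log_le ℓ
  obtain ⟨e, he⟩ := exists_lt_two_pow_log_add (ℓ + 1) (c₀ + cp + 1)
  refine ⟨(ℓ * c + ∑ i, c₁ i + c₂ + 2 * ℓ + 1) * (e + 1), fun nn P x hx => ?_⟩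
  set n := Finset.univ.sup nn with hn
  set b := Nat.log 2 n + e
  have hb : (ℓ + 1) * n + (c₀ + cp + 1) < 2 ^ b := he n
  set u := encMProt P with hu
  set z := encRectL (P.trans x) with hz
  have hnn i : nn i ≤ n := Finset.le_sup (Finset.mem_univ i)
  have hsum : ∑ i, nn i ≤ ℓ * n := by
    simpa using Finset.sum_le_card_nsmul Finset.univ nn n fun i _ => hnn i
  have hℓn : (ℓ + 1) * n = ℓ * n + n := by ring
  have hk : KC U z u ≤ ∑ i, nn i + c₀ := hc₀ ℓ nn P x hx
  have hm i (v : List Bool) : KC U (x i) v ≤ n + cp :=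
    (hcp _ _).trans (by rw [hx i]; exact Nat.add_le_add_right (hnn i) _)
  have hmb i : KC U (x i) u < 2 ^ b := by have := hm i u; omega
  choose X hX hXc using fun i => exists_finset_hasProg U u (KC U (x i) u)
  let Y (i : Fin ℓ) : Finset (List Bool) := X i ∩ (P.trans x i).toFinset
  have hY i s : s ∈ Y i ↔ s ∈ P.trans x i ∧ HasProg U s u (KC U (x i) u) := by
    simp [Y, hX, and_comm]
  have hxY i : x i ∈ Y i := (hY i _).2 ⟨P.trans_contains x hx i, hU.exists_prog _ _⟩
  have h1 i : KC U z (ePair (x i) u) + KC U (x i) u ≤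
      KC U z u + KC U (x i) (ePair z u) + c * (b + 1) := by
    refine hc u z (x i) b ?_
    have := hm i (ePair z u)
    omega
  have h2 i : KC U (x i) (ePair z u) ≤ Nat.log 2 (Y i).card + 1 + c₁ i * (b + 1) :=
    hc₁ i u (P.trans x) (x i) _ b _ (Y i) (hmb i) (P.trans_contains x hx i)
      (hU.exists_prog _ _) (fun s hs hs' => (hY i s).2 ⟨hs, hs'⟩)
      (Nat.lt_pow_succ_log_self one_lt_two _).le
  have h3 := hc₂ nn P x b (Nat.log 2 (rectThickL P (P.trans x)) + 1) (fun i => KC U (x i) u) Y hx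
    hmb (by omega) hY hxY (Nat.lt_pow_succ_log_self one_lt_two _).le
  have h4 := Finset.sum_le_sum fun i (_ : i ∈ Finset.univ) =>
    (h1 i).trans (Nat.add_le_add_right (Nat.add_le_add_left (h2 i) _) _)
  simp only [Finset.sum_add_distrib, ← Finset.sum_mul, Finset.sum_const, Finset.card_univ,
    Fintype.card_fin, smul_eq_mul, mul_one] at h3 h4
  have h5 : b + 1 ≤ (e + 1) * (Nat.log 2 n + 1) := by
    have : b = Nat.log 2 n + e := rfl
    nlinarith
  have h6 : (ℓ * c + ∑ i, c₁ i + c₂ + 2 * ℓ + 1) * (b + 1) ≤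
      (ℓ * c + ∑ i, c₁ i + c₂ + 2 * ℓ + 1) * (e + 1) * (Nat.log 2 n + 1) := by
    rw [mul_assoc]
    exact Nat.mul_le_mul_left _ h5
  have h7 : 2 * ℓ + 1 ≤ (2 * ℓ + 1) * (b + 1) := Nat.le_mul_of_pos_right _ b.succ_pos
  nlinarith

end IsUniversal

/-- Lower bound on the complexity of the transcript of an `ℓ`-party protocol. -/
theorem stmt15 (ℓ : ℕ) (hℓ : 2 ≤ ℓ) (U : Machine) (hU : IsUniversal U) :
    ∃ d : ℝ, ∀ nn : Fin ℓ → ℕ, ∀ P : MProtocol ℓ nn, ∀ x : Fin ℓ → List Bool,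
      (∀ i, (x i).length = nn i) →
      (KC U (encRectL (P.trans x)) (encMProt P) : ℝ) ≥
        (1 / ((ℓ : ℝ) - 1))
            * (∑ i : Fin ℓ, (KC U (encRectL (P.trans x)) (ePair (x i) (encMProt P)) : ℝ))
          - (1 / ((ℓ : ℝ) - 1)) * Real.logb 2 (rectThickL P (P.trans x))
          - d * Real.logb 2 ((Finset.univ.sup nn : ℕ) : ℝ) - d := by
  obtain ⟨K, hK⟩ := hU.sum_KC_trans_le ℓ
  refine ⟨K, fun nn P x hx => ?_⟩
  have h := hK nn P x hx
  set n := Finset.univ.sup nn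
  have hK' : (∑ i, (KC U (encRectL (P.trans x)) (ePair (x i) (encMProt P)) : ℝ)) +
      KC U (encRectL (P.trans x)) (encMProt P) ≤
        ℓ * KC U (encRectL (P.trans x)) (encMProt P) + Nat.log 2 (rectThickL P (P.trans x)) +
          K * (Nat.log 2 n + 1) := by
    exact_mod_cast h
  have hρ : (Nat.log 2 (rectThickL P (P.trans x)) : ℝ) ≤
      Real.logb 2 (rectThickL P (P.trans x)) := by
    exact_mod_cast Real.natLog_le_logb (rectThickL P (P.trans x)) 2
  have hn : (Nat.log 2 n : ℝ) ≤ Real.logb 2 n := by exact_mod_cast Real.natLog_le_logb n 2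
  have hℓ' : (1 : ℝ) ≤ (ℓ : ℝ) - 1 := by
    have : (2 : ℝ) ≤ ℓ := by exact_mod_cast hℓ
    linarith
  have hK₀ : (0 : ℝ) ≤ K * (Real.logb 2 n + 1) :=
    mul_nonneg K.cast_nonneg (by have : (0 : ℝ) ≤ Nat.log 2 n := Nat.cast_nonneg _; linarith)
  have hKn : (K : ℝ) * (Nat.log 2 n + 1) ≤ K * (Real.logb 2 n + 1) := by gcongr
  have key : (1 / ((ℓ : ℝ) - 1)) *
      (∑ i, (KC U (encRectL (P.trans x)) (ePair (x i) (encMProt P)) : ℝ) -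
        Real.logb 2 (rectThickL P (P.trans x))) ≤
      KC U (encRectL (P.trans x)) (encMProt P) + K * (Real.logb 2 n + 1) := by
    rw [one_div, inv_mul_le_iff₀ (by linarith)]
    nlinarith [mul_nonneg (sub_nonneg.2 hℓ') hK₀]
  rw [mul_sub] at key
  linarith
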